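/- Fix η ∈ (0, 1/2) and integers d ≥ 2, N ≥ 1. Let w₁ ∈ W be a fixed point such that dist_d(c, w₁)² ∈ [1/12 + 1/(6N) − 1/(2√6·d^η), 1/12 + 1/(6N) + 1/(2√6·d^η)], where c = (N/2, …, N/2) is the center of the hypercube. Then the proportion of points w₂ ∈ W with |dist_d(w₁, w₂) − √(1/6 + 1/(3N))| ≥ 1/d^η is at most (102/15)·(1/d^{1−2η}). -/

import Mathlib

/-- Euclidean distance between two points of `ℝ^d`. -/
noncomputable def dE {d : ℕ} (x y : Fin d → ℝ) : ℝ :=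
  Real.sqrt (∑ i, (x i - y i) ^ 2)

/-- Normalized distance `dist(x,y)/(√d · N)`. -/
noncomputable def dn (d N : ℕ) (x y : Fin d → ℝ) : ℝ :=
  dE x y / (Real.sqrt d * N)

/-- The lattice points `{0,1,…,N}^d` of the hypercube `[0,N]^d`. -/
noncomputable def cubeW (d N : ℕ) : Finset (Fin d → ℝ) :=
  Finset.image (fun f : Fin d → Fin (N + 1) => fun i => (f i : ℝ)) Finset.univ

/-- The `2^d` vertices `{0,N}^d` of the hypercube `[0,N]^d`. -/
noncomputable def cubeV (d N : ℕ) : Finset (Fin d → ℝ) :=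
  Finset.image (fun f : Fin d → Bool => fun i => if f i then (N : ℝ) else 0) Finset.univ

/-- The center `(N/2, …, N/2)` of the hypercube `[0,N]^d`. -/
noncomputable def ctr (d N : ℕ) : Fin d → ℝ := fun _ => (N : ℝ) / 2

/-- Average of squared Euclidean distances from `a` to the vertices. -/
noncomputable def A_V (d N : ℕ) (a : Fin d → ℝ) : ℝ :=
  (∑ v ∈ cubeV d N, dE v a ^ 2) / 2 ^ d

/-- Normalized average of squared distances from `a` to the vertices. -/
noncomputable def B_V (d N : ℕ) (a : Fin d → ℝ) : ℝ :=
  A_V d N a / (d * (N : ℝ) ^ 2)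

/-- Average of squared Euclidean distances from `a` to the lattice points. -/
noncomputable def A_W (d N : ℕ) (a : Fin d → ℝ) : ℝ :=
  (∑ w ∈ cubeW d N, dE w a ^ 2) / ((N : ℝ) + 1) ^ d

/-- Normalized average of squared distances from `a` to the lattice points. -/
noncomputable def B_W (d N : ℕ) (a : Fin d → ℝ) : ℝ :=
  A_W d N a / (d * (N : ℝ) ^ 2)

open Classical in
/-- Number of elements of a finite set satisfying a predicate. -/
noncomputable def pcount {α : Type*} (s : Finset α) (p : α → Prop) : ℕ :=
  (s.filter p).card

open Classical in
/-- Ordered pairs of vertices forming a non-degenerate triangle with `a`. -/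
noncomputable def TaV (d N : ℕ) (a : Fin d → ℝ) : Finset ((Fin d → ℝ) × (Fin d → ℝ)) :=
  ((cubeV d N) ×ˢ (cubeV d N)).filter (fun p => a ≠ p.1 ∧ a ≠ p.2 ∧ p.1 ≠ p.2)

open Classical in
/-- Ordered pairs of lattice points forming a non-degenerate triangle with `a`. -/
noncomputable def TaW (d N : ℕ) (a : Fin d → ℝ) : Finset ((Fin d → ℝ) × (Fin d → ℝ)) :=
  ((cubeW d N) ×ˢ (cubeW d N)).filter (fun p => a ≠ p.1 ∧ a ≠ p.2 ∧ p.1 ≠ p.2)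

/-- Cosine of the angle at `c` in the triangle `(a, c, v)`. -/
noncomputable def cosAngleAt {d : ℕ} (c a v : Fin d → ℝ) : ℝ :=
  (∑ i, (a i - c i) * (v i - c i)) / (dE a c * dE v c)

/-- A sum of centred functions of independent uniform coordinates has second moment at most the
sum of the second moments. -/
lemma sum_sq_sum_le_of_centered {α : Type*} [Fintype α] (C : ℝ) :
    ∀ (d : ℕ) (g : Fin d → α → ℝ), (∀ i, ∑ x, g i x = 0) →
      (∀ i, ∑ x, g i x ^ 2 ≤ Fintype.card α * C) →
      ∑ f : Fin d → α, (∑ i, g i (f i)) ^ 2 ≤ d * C * (Fintype.card α : ℝ) ^ d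
  | 0, _, _, _ => by simp
  | d + 1, g, h0, h2 => by
    have ih := sum_sq_sum_le_of_centered C d (fun i => g i.succ) (fun i => h0 _) (fun i => h2 _)
    have key : ∑ f : Fin (d + 1) → α, (∑ i, g i (f i)) ^ 2 =
        (Fintype.card α : ℝ) ^ d * ∑ x, g 0 x ^ 2 +
          Fintype.card α * ∑ f : Fin d → α, (∑ i, g i.succ (f i)) ^ 2 := by
      rw [← (Fin.consEquiv fun _ => α).sum_comp, Fintype.sum_prod_type]
      simp only [Fin.consEquiv_apply, Fin.sum_univ_succ, Fin.cons_zero, Fin.cons_succ, add_sq,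
        Finset.sum_add_distrib, ← Finset.mul_sum, ← Finset.sum_mul, h0]
      simp [Finset.mul_sum]
    rw [key]
    have h1 := mul_le_mul_of_nonneg_left (h2 0) (by positivity : (0 : ℝ) ≤ Fintype.card α ^ d)
    have h3 := mul_le_mul_of_nonneg_left ih (by positivity : (0 : ℝ) ≤ Fintype.card α)
    calc _ ≤ _ := add_le_add h1 h3
      _ = _ := by push_cast; ring

/-- Popoviciu's inequality on variances, for a function with values in `[0, 1]`. -/
lemma sum_sub_mean_sq_le {α : Type*} [Fintype α] (Y : α → ℝ) (μ : ℝ)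
    (hY0 : ∀ x, 0 ≤ Y x) (hY1 : ∀ x, Y x ≤ 1) (hμ : ∑ x, (Y x - μ) = 0) :
    ∑ x, (Y x - μ) ^ 2 ≤ Fintype.card α * (1 / 4) := by
  have hle : ∀ x, (Y x - μ) ^ 2 ≤ (1 - 2 * μ) * (Y x - μ) + 1 / 4 := fun x => by
    nlinarith [mul_nonneg (hY0 x) (sub_nonneg.2 (hY1 x)), sq_nonneg (μ - 1 / 2)]
  calc _ ≤ ∑ x, ((1 - 2 * μ) * (Y x - μ) + 1 / 4) := Finset.sum_le_sum fun x _ => hle x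
    _ = _ := by simp [Finset.sum_add_distrib, ← Finset.mul_sum, hμ]

lemma sum_range_sub_sq (N : ℕ) (w : ℝ) :
    ∑ x ∈ Finset.range (N + 1), (w - (x : ℝ)) ^ 2 =
      (N + 1) * ((w - N / 2) ^ 2 + N * (N + 2) / 12) := by
  induction N with
  | zero => simp
  | succ n ih =>
    rw [Finset.sum_range_succ, ih]
    push_cast
    ring

lemma natCast_comp_injective (d N : ℕ) :
    Function.Injective (fun f : Fin d → Fin (N + 1) => fun i => ((f i : ℕ) : ℝ)) := fun f g h => by
  ext i
  have hi : ((f i : ℕ) : ℝ) = (g i : ℕ) := congrFun h i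
  exact_mod_cast hi

lemma card_cubeW (d N : ℕ) : (cubeW d N).card = (N + 1) ^ d := by
  rw [cubeW, Finset.card_image_of_injective _ (natCast_comp_injective d N)]
  simp

/-- Chebyshev's inequality for counting. -/
lemma pcount_mul_le_sum {α : Type*} (s : Finset α) (p : α → Prop) (F : α → ℝ) (t : ℝ)
    (hF : ∀ x ∈ s, 0 ≤ F x) (hp : ∀ x ∈ s, p x → t ≤ F x) :
    (pcount s p : ℝ) * t ≤ ∑ x ∈ s, F x := by
  classical
  rw [pcount, ← nsmul_eq_mul]
  calc _ ≤ ∑ x ∈ s with p x, F x := by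
        convert Finset.card_nsmul_le_sum (s.filter p) F t fun x hx =>
          hp x (Finset.mem_filter.1 hx).1 (Finset.mem_filter.1 hx).2
    _ ≤ _ := Finset.sum_le_sum_of_subset_of_nonneg (Finset.filter_subset _ _)
        fun x hx _ => hF x hx

lemma dn_sq {d N : ℕ} (x y : Fin d → ℝ) :
    dn d N x y ^ 2 = (∑ i, (x i - y i) ^ 2 / (N : ℝ) ^ 2) / d := by
  rw [dn, dE, div_pow, mul_pow, Real.sq_sqrt (Finset.sum_nonneg fun i _ => sq_nonneg _),
    Real.sq_sqrt d.cast_nonneg, ← Finset.sum_div, div_div, mul_comm (d : ℝ)]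

lemma dn_nonneg {d N : ℕ} (x y : Fin d → ℝ) : 0 ≤ dn d N x y := by
  unfold dn dE
  positivity

/-- The second moment of the deviation of the squared normalized distance from its mean. -/
lemma sum_dn_sq_sub_mean_sq_le {d N : ℕ} (hd : 0 < d) (hN : 0 < N) {w₁ : Fin d → ℝ}
    (hw₁ : w₁ ∈ cubeW d N) :
    ∑ w₂ ∈ cubeW d N, (dn d N w₁ w₂ ^ 2 -
        (dn d N (ctr d N) w₁ ^ 2 + (1 / 12 + 1 / (6 * (N : ℝ))))) ^ 2 ≤
      ((N : ℝ) + 1) ^ d / (4 * d) := by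
  have hNr : (0 : ℝ) < N := by exact_mod_cast hN
  have hdr : (0 : ℝ) < d := by exact_mod_cast hd
  obtain ⟨w, -, rfl⟩ := Finset.mem_image.1 hw₁
  set μ : Fin d → ℝ := fun i =>
    ((N : ℝ) / 2 - (w i : ℕ)) ^ 2 / (N : ℝ) ^ 2 + (1 / 12 + 1 / (6 * (N : ℝ))) with hμ
  set Y : Fin d → Fin (N + 1) → ℝ := fun i x =>
    (((w i : ℕ) : ℝ) - (x : ℕ)) ^ 2 / (N : ℝ) ^ 2 with hY
  have h0 : ∀ i, ∑ x, (Y i x - μ i) = 0 := fun i => by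
    have := sum_range_sub_sq N (w i : ℕ)
    rw [← Fin.sum_univ_eq_sum_range (fun x : ℕ => (((w i : ℕ) : ℝ) - (x : ℝ)) ^ 2)] at this
    simp only [hY, Finset.sum_sub_distrib, ← Finset.sum_div, this, hμ]
    simp
    field_simp
    ring
  have hY1 : ∀ i x, Y i x ≤ 1 := fun i x => by
    rw [hY, div_le_one (by positivity), sq_le_sq, abs_of_pos hNr]
    have hw : ((w i : ℕ) : ℝ) ≤ N := by exact_mod_cast Nat.lt_succ_iff.1 (w i).2
    have hx : ((x : ℕ) : ℝ) ≤ N := by exact_mod_cast Nat.lt_succ_iff.1 x.2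
    rw [abs_le]
    constructor <;> linarith [((w i : ℕ)).cast_nonneg (α := ℝ), ((x : ℕ)).cast_nonneg (α := ℝ)]
  have main := sum_sq_sum_le_of_centered (1 / 4) d (fun i x => Y i x - μ i) h0 fun i =>
    sum_sub_mean_sq_le (Y i) (μ i) (fun x => by positivity) (hY1 i) (h0 i)
  rw [cubeW, Finset.sum_image (natCast_comp_injective d N).injOn]
  calc _ = (∑ f : Fin d → Fin (N + 1), (∑ i, (Y i (f i) - μ i)) ^ 2) / (d : ℝ) ^ 2 := by
        rw [Finset.sum_div]
        refine Finset.sum_congr rfl fun f _ => ?_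
        rw [← div_pow, dn_sq, dn_sq]
        simp only [hY, hμ, ctr, Finset.sum_sub_distrib, Finset.sum_add_distrib]
        simp
        field_simp
    _ ≤ (d * (1 / 4) * (Fintype.card (Fin (N + 1)) : ℝ) ^ d) / (d : ℝ) ^ 2 := by gcongr
    _ = _ := by
        simp
        field_simp

theorem stmt19 (η : ℝ) (hη : η ∈ Set.Ioo (0 : ℝ) (1 / 2)) (d N : ℕ) (hd : 2 ≤ d) (hN : 1 ≤ N)
    (w₁ : Fin d → ℝ) (hw₁ : w₁ ∈ cubeW d N)
    (h : dn d N (ctr d N) w₁ ^ 2 ∈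
        Set.Icc (1 / 12 + 1 / (6 * (N : ℝ)) - 1 / (2 * Real.sqrt 6 * (d : ℝ) ^ η))
          (1 / 12 + 1 / (6 * (N : ℝ)) + 1 / (2 * Real.sqrt 6 * (d : ℝ) ^ η))) :
    (pcount (cubeW d N)
        (fun w₂ => 1 / (d : ℝ) ^ η ≤ |dn d N w₁ w₂ - Real.sqrt (1 / 6 + 1 / (3 * (N : ℝ)))|) : ℝ) /
        (cubeW d N).card ≤
      (102 / 15) * (1 / (d : ℝ) ^ ((1 : ℝ) - 2 * η)) := by
  have hNr : (0 : ℝ) < N := by exact_mod_cast hN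
  have hdr : (0 : ℝ) < d := by positivity
  set ε : ℝ := 1 / (d : ℝ) ^ η with hε
  have hε0 : 0 < ε := by positivity
  have h6sq : (1 / Real.sqrt 6) ^ 2 = 1 / 6 := by
    rw [div_pow, Real.sq_sqrt (by norm_num), one_pow]
  set m : ℝ := 1 / 6 + 1 / (3 * (N : ℝ)) with hm
  have hm0 : 0 ≤ m := by positivity
  have hm6 : 1 / Real.sqrt 6 ≤ Real.sqrt m := by
    refine Real.le_sqrt_of_sq_le ?_
    rw [h6sq, hm]
    linarith [show (0 : ℝ) ≤ 1 / (3 * N) by positivity]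
  have hrad : 1 / (2 * Real.sqrt 6 * (d : ℝ) ^ η) = ε * (1 / Real.sqrt 6) / 2 := by
    rw [hε]
    field_simp
  have hhalf : m = 1 / 12 + 1 / (6 * (N : ℝ)) + (1 / 12 + 1 / (6 * (N : ℝ))) := by
    rw [hm]
    field_simp
    ring
  rw [hrad] at h
  have hdev : ∀ w₂ ∈ cubeW d N, ε ≤ |dn d N w₁ w₂ - Real.sqrt m| →
      ε ^ 2 / 24 ≤ (dn d N w₁ w₂ ^ 2 -
        (dn d N (ctr d N) w₁ ^ 2 + (1 / 12 + 1 / (6 * (N : ℝ))))) ^ 2 := fun w₂ _ hw => by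
    have hD := dn_nonneg (N := N) w₁ w₂
    have hfac : ε * (1 / Real.sqrt 6) ≤ |dn d N w₁ w₂ ^ 2 - m| := by
      rw [← Real.sq_sqrt hm0, sq_sub_sq, abs_mul, mul_comm ε,
        abs_of_nonneg (add_nonneg hD (Real.sqrt_nonneg m))]
      exact mul_le_mul (by linarith) hw hε0.le (by positivity)
    have hmean : |dn d N (ctr d N) w₁ ^ 2 + (1 / 12 + 1 / (6 * (N : ℝ))) - m| ≤
        ε * (1 / Real.sqrt 6) / 2 := by
      rw [abs_le]
      constructor <;> linarith [h.1, h.2]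
    have htri := abs_sub_le (dn d N w₁ w₂ ^ 2)
      (dn d N (ctr d N) w₁ ^ 2 + (1 / 12 + 1 / (6 * (N : ℝ)))) m
    calc ε ^ 2 / 24 = (ε * (1 / Real.sqrt 6) / 2) ^ 2 := by
          linear_combination (-ε ^ 2 / 4) * h6sq
      _ ≤ |dn d N w₁ w₂ ^ 2 -
          (dn d N (ctr d N) w₁ ^ 2 + (1 / 12 + 1 / (6 * (N : ℝ))))| ^ 2 := by
          gcongr
          linarith
      _ = _ := sq_abs _
  have hcheb := (pcount_mul_le_sum _ _ _ _ (fun _ _ => sq_nonneg _) hdev).trans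
    (sum_dn_sq_sub_mean_sq_le (by omega) hN hw₁)
  have hpow : 1 / (d : ℝ) ^ ((1 : ℝ) - 2 * η) = 1 / (d * ε ^ 2) := by
    rw [Real.rpow_sub hdr, Real.rpow_one, two_mul, Real.rpow_add hdr, hε]
    field_simp
  rw [hpow, card_cubeW, div_le_iff₀ (by positivity)]
  push_cast
  rw [← le_div_iff₀ (by positivity)] at hcheb
  calc _ ≤ _ := hcheb
    _ = 6 * (1 / (d * ε ^ 2)) * ((N : ℝ) + 1) ^ d := by
      field_simp
      norm_num
    _ ≤ _ := by
      gcongr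
      norm_num
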